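/- Assume R < S, let t and k be integers with 0 <= t <= min(r_n - 1, s_n) and R+1 <= k <= S, and suppose l = t p^n + k satisfies max(r+s-p^{n+1},0)+1 <= l <= min(r,s). Then: (1) the element z_l = (-1)^R sum_{i=0}^{t} (-1)^{i+k-1} v_{(i+1) p^n + R + 1 - k, (t-i) p^n + S} of M(r,s) satisfies T^{p^n - 1}(z_l) = x_{t p^n + R + S + 1 - k}; (2) the (t+1) x (t+1) matrix M(3) over F with (i,j) entry C(r_n+s_n-2t-1, r_n-t+j-i-1) is invertible, and with zeta = M(3)^{-1} X, where X is the column vector of length t+1 with i-th entry (-1)^{i-1}, the element y_l = (-1)^{R+k-1} sum_{i=0}^{t} zeta_{i+1} v_{(r_n-t+i) p^n + R + 1 - k, (s_n-i) p^n + S} satisfies T^{(r_n+s_n-2t-1) p^n}(y_l) = z_l. -/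

import Mathlib

open scoped BigOperators

noncomputable section

/-- The basis vector `v_{a,b}` of `M(r,s)` (1-indexed), read as `0` when
`a` or `b` is out of range. -/
def vv (F : Type*) [Field F] (r s : ℕ) (a b : ℤ) : Matrix (Fin r) (Fin s) F :=
  Matrix.of fun i j => if (i : ℤ) + 1 = a ∧ (j : ℤ) + 1 = b then 1 else 0

/-- The linear endomorphism `T` of `M(r,s)` with `T(v_{i,j}) = v_{i-1,j} + v_{i,j-1}`
(out-of-range symbols read as `0`); it models the action of `g - 1`. -/
def TT (F : Type*) [Field F] (r s : ℕ) :
    Matrix (Fin r) (Fin s) F →ₗ[F] Matrix (Fin r) (Fin s) F where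
  toFun A := Matrix.of fun i j =>
    (if h : (i : ℕ) + 1 < r then A ⟨(i : ℕ) + 1, h⟩ j else 0) +
    (if h : (j : ℕ) + 1 < s then A i ⟨(j : ℕ) + 1, h⟩ else 0)
  map_add' A B := by
    ext i j
    simp only [Matrix.of_apply, Matrix.add_apply]
    split_ifs <;> abel
  map_smul' c A := by
    ext i j
    simp only [Matrix.of_apply, Matrix.smul_apply, RingHom.id_apply, smul_eq_mul]
    split_ifs <;> ring

/-- `x_m = ∑_{j=1}^m (-1)^{j-1} v_{j, m+1-j}` (the empty sum if `m ≤ 0`). -/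
def xx (F : Type*) [Field F] (r s : ℕ) (m : ℤ) : Matrix (Fin r) (Fin s) F :=
  ∑ j ∈ Finset.range m.toNat, ((-1 : F) ^ j) • vv F r s ((j : ℤ) + 1) (m - j)

/-- The subspace `D_d` of `M(r,s)`, spanned by the `v_{i,j}` with `i + j = d + 1`. -/
def Dd (F : Type*) [Field F] (r s : ℕ) (d : ℕ) :
    Submodule F (Matrix (Fin r) (Fin s) F) :=
  Submodule.span F { A | ∃ a b : ℕ, 1 ≤ a ∧ a ≤ r ∧ 1 ≤ b ∧ b ≤ s ∧
    a + b = d + 1 ∧ A = vv F r s (a : ℤ) (b : ℤ) }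

/-- Binomial coefficient `C(a,b)` as an element of `F`, with the convention that
it is `0` when `b < 0` or `b > a`. -/
def binF (F : Type*) [Field F] (a b : ℤ) : F :=
  if 0 ≤ b ∧ b ≤ a then (Nat.choose a.toNat b.toNat : F) else 0

/-- `lam` (restricted to indices `1,…,min r s`) is the Jordan type of the nilpotent
operator `T` on `M(r,s)`: a nonincreasing list of `min r s` positive integers such that
for each `m ≥ 1` the number of parts `≥ m` is `rank T^{m-1} - rank T^m`. -/
def IsJordanType (F : Type*) [Field F] (r s : ℕ) (lam : ℕ → ℕ) : Prop :=
  (∀ l, 1 ≤ l → l ≤ min r s → 0 < lam l) ∧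
  (∀ l l', 1 ≤ l → l ≤ l' → l' ≤ min r s → lam l' ≤ lam l) ∧
  ∀ m, 1 ≤ m →
    ((Finset.Icc 1 (min r s)).filter fun l => m ≤ lam l).card =
      Module.finrank F ↥(LinearMap.range ((TT F r s) ^ (m - 1))) -
      Module.finrank F ↥(LinearMap.range ((TT F r s) ^ m))

section SparsePolynomials

open Polynomial

/-- In characteristic `p`, a nonzero polynomial of degree less than `p` which is divisible by
`(X + 1) ^ N` has more than `N` nonzero coefficients. -/
theorem lt_card_support_of_X_add_one_pow_dvd {F : Type*} [Field F] (p : ℕ) [CharP F p] (N : ℕ) :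
    ∀ P : F[X], P ≠ 0 → P.natDegree < p → (X + 1) ^ N ∣ P → N < P.support.card := by
  induction N with
  | zero =>
    intro P hP _ _
    exact Finset.card_pos.mpr (nonempty_support_iff.mpr hP)
  | succ N ih =>
    intro P hP hdeg hdvd
    obtain ⟨c, hc⟩ := nonempty_support_iff.mpr hP
    have hcoeff (m : ℕ) : (X * derivative P - C (c : F) * P).coeff m = (m - c) * P.coeff m := by
      cases m with
      | zero => simp
      | succ m => simp [coeff_derivative]; ring
    have hsupp : (X * derivative P - C (c : F) * P).support ⊆ P.support.erase c := by
      intro m hm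
      rw [mem_support_iff, hcoeff] at hm
      rw [Finset.mem_erase, mem_support_iff]
      refine ⟨?_, right_ne_zero_of_mul hm⟩
      rintro rfl
      simp at hm
    have hne : X * derivative P - C (c : F) * P ≠ 0 := by
      intro h0
      have hmono : P = monomial c (P.coeff c) := by
        ext m
        rw [coeff_monomial]
        split_ifs with hmc
        · rw [hmc]
        · by_contra hm
          have h1 := hcoeff m
          rw [h0, coeff_zero, eq_comm, mul_eq_zero, or_iff_left hm, sub_eq_zero] at h1
          have hmp : m < p := (le_natDegree_of_ne_zero hm).trans_lt hdeg
          have hcp : c < p := (le_natDegree_of_mem_supp c hc).trans_lt hdeg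
          exact hmc (CharP.natCast_injOn_Iio F p hcp hmp h1.symm)
      have hroot : P.eval (-1) = 0 := by
        obtain ⟨Q, hQ⟩ := hdvd
        simp [hQ]
      rw [hmono, eval_monomial] at hroot
      rw [mem_support_iff] at hc
      simp [hc] at hroot
    have hdvd' : (X + 1) ^ N ∣ X * derivative P - C (c : F) * P := by
      obtain ⟨Q, rfl⟩ := hdvd
      refine dvd_sub (Dvd.dvd.mul_left ?_ _) (Dvd.dvd.mul_left ?_ _)
      · rw [derivative_mul, derivative_pow_succ]
        refine dvd_add (Dvd.dvd.mul_right (Dvd.dvd.mul_right (Dvd.intro_left _ rfl) _) _) ?_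
        exact (pow_dvd_pow _ N.le_succ).mul_right _
      · exact (pow_dvd_pow _ N.le_succ).mul_right _
    have hdeg' : (X * derivative P - C (c : F) * P).natDegree < p := by
      refine lt_of_le_of_lt ?_ hdeg
      rw [natDegree_le_iff_coeff_eq_zero]
      intro m hm
      rw [hcoeff, coeff_eq_zero_of_natDegree_lt hm, mul_zero]
    have h1 := ih _ hne hdeg' hdvd'
    have h2 := Finset.card_le_card hsupp
    rw [Finset.card_erase_of_mem hc] at h2
    omega

/-- The Toeplitz matrix of binomial coefficients `C(N, a + j - i)` of size `t + 1` is invertible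
in characteristic `p` as soon as `a ≤ N` and `N + t < p`. -/
theorem isUnit_binomial_toeplitz {F : Type*} [Field F] (p : ℕ) [CharP F p] {N a t : ℕ}
    (haN : a ≤ N) (hNt : N + t < p) (A : Matrix (Fin (t + 1)) (Fin (t + 1)) F)
    (hA : ∀ i j : Fin (t + 1), A i j = binF F N ((a : ℤ) + j - i)) : IsUnit A := by
  rw [← Matrix.mulVec_injective_iff_isUnit]
  refine (injective_iff_map_eq_zero A.mulVecLin).mpr fun v hv => ?_
  set f : F[X] := ∑ j : Fin (t + 1), C (v j) * X ^ (t - (j : ℕ)) with hf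
  have hf_deg : f.natDegree ≤ t := by
    refine natDegree_sum_le_of_forall_le _ _ fun j _ => ?_
    exact (natDegree_C_mul_X_pow_le _ _).trans (Nat.sub_le _ _)
  have hf_coeff (j : Fin (t + 1)) : f.coeff (t - (j : ℕ)) = v j := by
    rw [hf, finsetSum_coeff, Finset.sum_eq_single j]
    · simp
    · intro i _ hij
      have : t - (j : ℕ) ≠ t - (i : ℕ) := by
        have := Fin.val_ne_of_ne hij
        omega
      simp [coeff_X_pow, this]
    · simp
  have hprod_deg : ((X + 1) ^ N * f).natDegree ≤ N + t := by
    refine natDegree_mul_le.trans (add_le_add ?_ hf_deg)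
    refine natDegree_pow_le.trans ?_
    rw [← C_1, natDegree_X_add_C, mul_one]
  have hgap (i : Fin (t + 1)) : ((X + 1) ^ N * f).coeff (a + t - i) = 0 := by
    have hi := congrFun hv i
    rw [Matrix.mulVecLin_apply, Matrix.mulVec, dotProduct, Pi.zero_apply] at hi
    rw [hf, Finset.mul_sum, finsetSum_coeff, ← hi]
    refine Finset.sum_congr rfl fun j _ => ?_
    rw [hA, mul_left_comm, coeff_C_mul, coeff_mul_X_pow', mul_comm, binF]
    congr 1
    have hit := i.is_lt
    have hjt := j.is_lt
    rw [coeff_X_add_one_pow]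
    by_cases h : 0 ≤ (a : ℤ) + j - i
    · have hsub : a + t - (i : ℕ) - (t - j) = ((a : ℤ) + j - i).toNat := by omega
      rw [if_pos (by omega), hsub]
      split_ifs with h'
      · simp
      · rw [Nat.choose_eq_zero_of_lt (by omega), Nat.cast_zero]
    · rw [if_neg (by omega), if_neg (by omega)]
  have hf0 : f = 0 := by
    by_contra hf0
    have hne : (X + 1) ^ N * f ≠ 0 := mul_ne_zero (pow_ne_zero _ (by
      rw [← C_1]; exact X_add_C_ne_zero 1)) hf0
    have hlt := lt_card_support_of_X_add_one_pow_dvd p N _ hne (hprod_deg.trans_lt hNt)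
      (Dvd.intro _ rfl)
    have hsub : ((X + 1) ^ N * f).support ⊆
        Finset.range (N + t + 1) \ Finset.Ico a (a + t + 1) := by
      intro m hm
      have hm1 := le_natDegree_of_mem_supp m hm
      rw [Finset.mem_sdiff, Finset.mem_range, Finset.mem_Ico]
      refine ⟨by omega, fun ⟨hm2, hm3⟩ => ?_⟩
      have hg := hgap ⟨a + t - m, by omega⟩
      rw [mem_support_iff] at hm
      have hm4 : a + t - (a + t - m) = m := by omega
      simp only [hm4] at hg
      exact hm hg
    have hle := Finset.card_le_card hsub
    rw [Finset.card_sdiff_of_subset, Finset.card_range, Nat.card_Ico] at hle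
    · omega
    · intro m hm
      rw [Finset.mem_Ico] at hm
      rw [Finset.mem_range]
      omega
  ext j
  rw [← hf_coeff j, hf0, coeff_zero, Pi.zero_apply]

end SparsePolynomials

section Binomials

/-- The binomial coefficients `C(p ^ n - 1, j)` alternate in sign in characteristic `p`. -/
theorem natCast_choose_pow_sub_one {F : Type*} [Field F] {p : ℕ} (hp : p.Prime) [CharP F p]
    (n : ℕ) {j : ℕ} (hj : j < p ^ n) : (((p ^ n - 1).choose j : ℕ) : F) = (-1) ^ j := by
  induction j with
  | zero => simp
  | succ j ih =>
    have hdvd : p ∣ (p ^ n).choose (j + 1) :=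
      hp.dvd_choose_pow j.succ_ne_zero hj.ne
    have hsucc : p ^ n = p ^ n - 1 + 1 := by omega
    rw [hsucc, Nat.choose_succ_succ, ← CharP.cast_eq_zero_iff F p, Nat.cast_add,
      ih (by omega)] at hdvd
    rw [pow_succ]
    linear_combination hdvd

/-- A binomial sum against a function supported on `{0, …, t}`, reindexed over the support. -/
theorem sum_choose_smul_eq_sum_binF {F V : Type*} [Field F] [AddCommGroup V] [Module F V]
    (N t : ℕ) (c : ℤ) (g : ℤ → V) (hg : ∀ z : ℤ, z < 0 ∨ t < z → g z = 0) :
    ∑ d ∈ Finset.range (N + 1), (N.choose d : F) • g (c - d) =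
      ∑ i : Fin (t + 1), binF F N (c - i) • g i := by
  have hexp (z : ℤ) : g z = ∑ i : Fin (t + 1), if z = i then g i else 0 := by
    by_cases hz : z < 0 ∨ t < z
    · rw [hg z hz, Finset.sum_eq_zero]
      intro i _
      rw [if_neg (by have := i.is_lt; omega)]
    · rw [Finset.sum_eq_single ⟨z.toNat, by omega⟩]
      · have : ((z.toNat : ℕ) : ℤ) = z := by omega
        simp [this]
      · intro i _ hi
        rw [if_neg]
        rintro rfl
        simp at hi
      · simp
  simp_rw [fun d : ℕ => hexp (c - d), Finset.smul_sum]
  rw [Finset.sum_comm]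
  refine Finset.sum_congr rfl fun i _ => ?_
  rw [binF]
  split_ifs with h
  · rw [Finset.sum_eq_single (c - i).toNat]
    · rw [if_pos (by omega), Int.toNat_natCast]
    · intro d _ hd
      rw [if_neg (by omega), smul_zero]
    · intro hd
      rw [Finset.mem_range] at hd
      omega
  · rw [zero_smul]
    refine Finset.sum_eq_zero fun d hd => ?_
    rw [Finset.mem_range] at hd
    rw [if_neg (by omega), smul_zero]

theorem sum_range_mul_eq {V : Type*} [AddCommMonoid V] (m q : ℕ) (f : ℕ → V) :
    ∑ u ∈ Finset.range (m * q), f u =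
      ∑ i ∈ Finset.range m, ∑ j ∈ Finset.range q, f (i * q + j) := by
  induction m with
  | zero => simp
  | succ m ih => rw [Nat.succ_mul, Finset.sum_range_add, ih, Finset.sum_range_succ]

end Binomials

section Shifts

variable {F : Type*} [Field F] {r s : ℕ}

theorem vv_eq_zero {a b : ℤ} (h : a ≤ 0 ∨ b ≤ 0) : vv F r s a b = 0 := by
  ext i j
  simp only [vv, Matrix.of_apply, Matrix.zero_apply]
  rw [if_neg (by omega)]

theorem TT_vv {a b : ℤ} (ha : a ≤ r) (hb : b ≤ s) :
    TT F r s (vv F r s a b) = vv F r s (a - 1) b + vv F r s a (b - 1) := by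
  ext i j
  have hi := i.is_lt
  have hj := j.is_lt
  simp only [TT, vv, LinearMap.coe_mk, AddHom.coe_mk, Matrix.of_apply, Matrix.add_apply]
  congr 1
  · split_ifs <;> first | rfl | (exfalso; push_cast at *; omega)
  · split_ifs <;> first | rfl | (exfalso; push_cast at *; omega)

/-- Binomial expansion of the powers of an endomorphism which acts on the basis as a sum of
two commuting shifts by `c`. -/
theorem pow_vv_of_shift (L : Module.End F (Matrix (Fin r) (Fin s) F)) (c : ℕ)
    (hL : ∀ a b : ℤ, a ≤ r → b ≤ s →
      L (vv F r s a b) = vv F r s (a - c) b + vv F r s a (b - c)) (m : ℕ) :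
    ∀ a b : ℤ, a ≤ r → b ≤ s → (L ^ m) (vv F r s a b) =
      ∑ d ∈ Finset.range (m + 1),
        (m.choose d : F) • vv F r s (a - c * d) (b - c * ((m : ℤ) - d)) := by
  induction m with
  | zero => intro a b _ _; simp
  | succ m ih =>
    intro a b ha hb
    rw [pow_succ, Module.End.mul_apply, hL a b ha hb, map_add, ih _ _ (by omega) hb,
      ih _ _ ha (by omega), Finset.sum_range_succ' _ (m + 1)]
    simp_rw [Nat.choose_succ_succ, Nat.cast_add, add_smul]
    rw [Finset.sum_add_distrib, add_assoc]
    congr 1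
    · refine Finset.sum_congr rfl fun d _ => ?_
      congr 2 <;> push_cast <;> ring
    · rw [Finset.sum_range_succ', Finset.sum_range_succ _ m,
        Nat.choose_succ_self, Nat.cast_zero (R := F), zero_smul, add_zero]
      congr 1
      · refine Finset.sum_congr rfl fun d _ => ?_
        congr 2 <;> push_cast <;> ring
      · simp only [Nat.choose_zero_right]
        congr 2 <;> push_cast <;> ring

theorem TT_pow_vv (m : ℕ) {a b : ℤ} (ha : a ≤ r) (hb : b ≤ s) :
    (TT F r s ^ m) (vv F r s a b) =
      ∑ d ∈ Finset.range (m + 1), (m.choose d : F) • vv F r s (a - d) (b - ((m : ℤ) - d)) := by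
  have h := pow_vv_of_shift (TT F r s) 1
    (fun a b ha hb => by simpa using TT_vv ha hb) m a b ha hb
  simpa using h

variable {p : ℕ} [CharP F p]

theorem TT_pow_char_pow_vv (hp : p.Prime) (n : ℕ) {a b : ℤ} (ha : a ≤ r) (hb : b ≤ s) :
    (TT F r s ^ p ^ n) (vv F r s a b) =
      vv F r s (a - (p ^ n : ℕ)) b + vv F r s a (b - (p ^ n : ℕ)) := by
  have hpos : 0 < p ^ n := pow_pos hp.pos n
  rw [TT_pow_vv _ ha hb, Finset.sum_range_succ, add_comm]
  congr 1
  · simp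
  · rw [Finset.sum_eq_single 0]
    · simp
    · intro d hd hd0
      rw [Finset.mem_range] at hd
      rw [(CharP.cast_eq_zero_iff F p _).mpr (hp.dvd_choose_pow hd0 hd.ne), zero_smul]
    · intro h
      exact absurd (Finset.mem_range.mpr hpos) h

theorem TT_pow_mul_char_pow_vv (hp : p.Prime) (n m : ℕ) {a b : ℤ} (ha : a ≤ r) (hb : b ≤ s) :
    (TT F r s ^ (m * p ^ n)) (vv F r s a b) =
      ∑ d ∈ Finset.range (m + 1), (m.choose d : F) •
        vv F r s (a - (p ^ n : ℕ) * d) (b - (p ^ n : ℕ) * ((m : ℤ) - d)) := by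
  rw [mul_comm, pow_mul]
  exact pow_vv_of_shift _ _ (fun a b ha hb => TT_pow_char_pow_vv hp n ha hb) m a b ha hb

theorem TT_pow_char_pow_sub_one_vv (hp : p.Prime) (n : ℕ) {a b : ℤ} (ha : a ≤ r) (hb : b ≤ s) :
    (TT F r s ^ (p ^ n - 1)) (vv F r s a b) =
      ∑ j ∈ Finset.range (p ^ n), (-1 : F) ^ (p ^ n - 1 - j) •
        vv F r s (a + j + 1 - (p ^ n : ℕ)) (b - j) := by
  have hpos : 0 < p ^ n := pow_pos hp.pos n
  rw [TT_pow_vv _ ha hb, Nat.sub_add_cancel hpos, ← Finset.sum_range_reflect]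
  refine Finset.sum_congr rfl fun j hj => ?_
  rw [Finset.mem_range] at hj
  rw [natCast_choose_pow_sub_one hp n (by omega)]
  congr 2 <;> omega

end Shifts

/-- The sum `x_m`, reindexed with the zero symbols on both sides. -/
theorem xx_eq_sum_range {F : Type*} [Field F] (r s m e M : ℕ) (hM : e + m ≤ M) :
    xx F r s m = ∑ u ∈ Finset.range M, (-1 : F) ^ (u + e) •
      vv F r s ((u : ℤ) + 1 - e) ((m : ℤ) + e - u) := by
  obtain ⟨d, rfl⟩ := Nat.exists_eq_add_of_le hM
  rw [Finset.sum_range_add, Finset.sum_range_add, xx, Int.toNat_natCast]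
  rw [Finset.sum_eq_zero (s := Finset.range e), Finset.sum_eq_zero (s := Finset.range d),
    zero_add, add_zero]
  · refine Finset.sum_congr rfl fun j _ => ?_
    have hsign : (-1 : F) ^ (e + j + e) = (-1) ^ j := by
      rw [show e + j + e = 2 * e + j by ring, pow_add, pow_mul]
      simp
    rw [hsign]
    congr 2 <;> push_cast <;> ring
  · intro u _
    rw [vv_eq_zero (by right; push_cast; omega), smul_zero]
  · intro u hu
    rw [Finset.mem_range] at hu
    rw [vv_eq_zero (by left; omega), smul_zero]

/-- case `R < S`, `R+1 ≤ k ≤ S`. -/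
theorem stmt17 (p : ℕ) (hp : p.Prime) (F : Type*) [Field F] [CharP F p]
    (r s n rn sn R S : ℕ) (hr : 0 < r) (hs : 0 < s)
    (hn1 : p ^ n ≤ max r s) (hn2 : max r s < p ^ (n + 1))
    (hrn : rn < p) (hsn : sn < p) (hRp : R < p ^ n) (hSp : S < p ^ n)
    (hrd : r = rn * p ^ n + R) (hsd : s = sn * p ^ n + S)
    (hRS : R < S)
    (t k l : ℕ) (ht : (t : ℤ) ≤ min ((rn : ℤ) - 1) (sn : ℤ))
    (hk1 : R + 1 ≤ k) (hk2 : k ≤ S)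
    (hl : l = t * p ^ n + k)
    (hl1 : max ((r : ℤ) + s - p ^ (n + 1)) 0 + 1 ≤ (l : ℤ)) (hl2 : l ≤ min r s)
    (zl : Matrix (Fin r) (Fin s) F)
    (hzl : zl = (-1 : F) ^ R •
      ∑ i ∈ Finset.range (t + 1), (-1 : F) ^ (i + k - 1) •
        vv F r s (((i : ℤ) + 1) * p ^ n + R + 1 - k) (((t : ℤ) - i) * p ^ n + S))
    (M3 : Matrix (Fin (t + 1)) (Fin (t + 1)) F)
    (hM3 : ∀ i j : Fin (t + 1), M3 i j =
      binF F ((rn : ℤ) + sn - 2 * t - 1) ((rn : ℤ) - t + (j : ℤ) - (i : ℤ) - 1))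
    (X : Fin (t + 1) → F) (hX : ∀ i : Fin (t + 1), X i = (-1 : F) ^ (i : ℕ))
    (zeta : Fin (t + 1) → F) (hzeta : zeta = M3⁻¹.mulVec X)
    (yl : Matrix (Fin r) (Fin s) F)
    (hyl : yl = (-1 : F) ^ (R + k - 1) •
      ∑ i : Fin (t + 1), zeta i •
        vv F r s (((rn : ℤ) - t + (i : ℤ)) * p ^ n + R + 1 - k)
          (((sn : ℤ) - (i : ℤ)) * p ^ n + S)) :
    ((TT F r s) ^ (p ^ n - 1)) zl
        = xx F r s ((t : ℤ) * p ^ n + R + S + 1 - k) ∧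
      IsUnit M3 ∧
      ((TT F r s) ^ ((rn + sn - 2 * t - 1) * p ^ n)) yl = zl := by
  have hqp : 0 < p ^ n := pow_pos hp.pos n
  have hneg : (-1 : F) ^ p ^ n = -1 := by
    have := Fact.mk hp
    exact neg_one_pow_char_pow F p n
  obtain ⟨e, rfl⟩ : ∃ e, k = R + 1 + e := Nat.exists_eq_add_of_le hk1
  obtain ⟨a, rfl⟩ : ∃ a, rn = t + 1 + a := Nat.exists_eq_add_of_le (by omega)
  obtain ⟨b, rfl⟩ : ∃ b, sn = t + b := Nat.exists_eq_add_of_le (by omega)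
  have hN : t + 1 + a + (t + b) - 2 * t - 1 = a + b := by omega
  have hNp : a + b + t < p := by
    by_contra! hge
    have h1 : p * p ^ n ≤ (a + b + t) * p ^ n := Nat.mul_le_mul_right _ hge
    have h2 : (r : ℤ) + s - p ^ (n + 1) + 1 ≤ l := by
      have := le_max_left ((r : ℤ) + s - p ^ (n + 1)) 0
      omega
    rw [hl, hrd, hsd, pow_succ] at h2
    zify at h1 hqp hk2 hSp
    push_cast at h2
    nlinarith
  have hM3' : ∀ i j : Fin (t + 1), M3 i j = binF F ((a + b : ℕ) : ℤ) ((a : ℤ) + j - i) := by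
    intro i j
    rw [hM3]
    congr 1 <;> push_cast <;> ring
  have hunit : IsUnit M3 := isUnit_binomial_toeplitz p (Nat.le_add_right a b) hNp M3 hM3'
  refine ⟨?_, hunit, ?_⟩
  · have hx : ((t : ℤ) * p ^ n + R + S + 1 - (R + 1 + e : ℕ)) =
        ((t * p ^ n + S - e : ℕ) : ℤ) := by
      rw [Nat.cast_sub (by omega)]
      push_cast
      ring
    have hS : e + (t * p ^ n + S - e) ≤ (t + 1) * p ^ n := by
      rw [Nat.succ_mul]
      omega
    rw [hx, xx_eq_sum_range r s _ e _ hS, sum_range_mul_eq, hzl, map_smul, map_sum,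
      Finset.smul_sum]
    refine Finset.sum_congr rfl fun i hi => ?_
    rw [Finset.mem_range] at hi
    rw [map_smul, TT_pow_char_pow_sub_one_vv hp n, Finset.smul_sum, Finset.smul_sum]
    · refine Finset.sum_congr rfl fun j hj => ?_
      rw [Finset.mem_range] at hj
      rw [smul_smul, smul_smul]
      congr 1
      · have hj' : (-1 : F) ^ (p ^ n - 1 - j) = (-1) ^ j := by
          have h1 : (-1 : F) ^ (p ^ n - 1 - j) * (-1) ^ (j + 1) = -1 := by
            rw [← pow_add, show p ^ n - 1 - j + (j + 1) = p ^ n by omega, hneg]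
          have h2 : (-1 : F) ^ j * (-1) ^ j = 1 := by rw [← mul_pow]; simp
          rw [pow_succ] at h1
          linear_combination -(-1 : F) ^ j * h1 - (-1 : F) ^ (p ^ n - 1 - j) * h2
        have hR : (-1 : F) ^ R * (-1) ^ R = 1 := by rw [← mul_pow]; simp
        rw [hj', show i + (R + 1 + e) - 1 = i + R + e by omega, mul_comm i, pow_add _ _ e,
          pow_add _ _ R, pow_add, pow_add, pow_mul, hneg]
        linear_combination (-1 : F) ^ i * (-1) ^ j * (-1) ^ e * hR
      · rw [Nat.cast_sub (by omega)]
        congr 1 <;> push_cast <;> ring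
    · have h1 : (i + 1) * p ^ n ≤ (t + 1 + a) * p ^ n := Nat.mul_le_mul_right _ (by omega)
      rw [hrd]
      zify at h1
      push_cast
      linarith
    · have h1 : (t - i) * p ^ n ≤ (t + b) * p ^ n := Nat.mul_le_mul_right _ (by omega)
      rw [hsd]
      zify [show i ≤ t by omega] at h1
      push_cast
      linarith
  · rw [hN]
    set g : ℤ → Matrix (Fin r) (Fin s) F := fun z =>
      vv F r s ((z + 1) * p ^ n - e) ((t - z) * p ^ n + S) with hg
    have hg0 (z : ℤ) (hz : z < 0 ∨ t < z) : g z = 0 := by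
      have hq : (0 : ℤ) < p ^ n := by exact_mod_cast hqp
      have hSq : (S : ℤ) < p ^ n := by exact_mod_cast hSp
      refine vv_eq_zero (hz.imp (fun h => ?_) fun h => ?_)
      · have : (z + 1) * (p : ℤ) ^ n ≤ 0 := mul_nonpos_of_nonpos_of_nonneg (by omega) hq.le
        omega
      · have : (t - z) * (p : ℤ) ^ n ≤ (-1) * p ^ n :=
          mul_le_mul_of_nonneg_right (by omega) hq.le
        omega
    have hT (i : Fin (t + 1)) : (TT F r s ^ ((a + b) * p ^ n))
        (vv F r s ((((t + 1 + a : ℕ) : ℤ) - t + (i : ℤ)) * p ^ n + R + 1 - (R + 1 + e : ℕ))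
          ((((t + b : ℕ) : ℤ) - (i : ℤ)) * p ^ n + S)) = ∑ j : Fin (t + 1), M3 j i • g j := by
      rw [TT_pow_mul_char_pow_vv hp n]
      · simp_rw [hM3']
        rw [← sum_choose_smul_eq_sum_binF _ _ _ _ hg0]
        refine Finset.sum_congr rfl fun d _ => ?_
        simp only [hg]
        congr 2 <;> push_cast <;> ring
      · have h1 : (1 + a + i) * p ^ n ≤ (t + 1 + a) * p ^ n :=
          Nat.mul_le_mul_right _ (by omega)
        rw [hrd]
        zify at h1
        push_cast
        linarith
      · have h1 : 0 ≤ (i : ℕ) * p ^ n := Nat.zero_le _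
        rw [hsd]
        zify at h1
        push_cast
        linarith
    have hsolve : M3.mulVec zeta = X := by
      rw [hzeta, Matrix.mulVec_mulVec, Matrix.mul_nonsing_inv _
        ((Matrix.isUnit_iff_isUnit_det _).mp hunit), Matrix.one_mulVec]
    rw [hyl, map_smul, map_sum, hzl]
    simp_rw [map_smul, hT, Finset.smul_sum]
    rw [Finset.sum_comm, Finset.sum_range]
    refine Finset.sum_congr rfl fun j _ => ?_
    have hj : ∑ i, M3 j i * zeta i = (-1 : F) ^ (j : ℕ) := by
      rw [← hX, ← hsolve]
      rfl
    simp_rw [smul_smul]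
    rw [← Finset.sum_smul]
    congr 1
    · rw [show (-1 : F) ^ R * (-1) ^ ((j : ℕ) + (R + 1 + e) - 1) =
        (-1) ^ (R + (R + 1 + e) - 1) * (-1) ^ (j : ℕ) by
          rw [← pow_add, ← pow_add]; congr 1; omega, ← hj, Finset.mul_sum]
      refine Finset.sum_congr rfl fun i _ => ?_
      ring
    · simp only [hg]
      congr 1 <;> push_cast <;> ring
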